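/- arXiv:2012.07183 — 5 statements merged into one kernel-verified Lean document; each statement's English description precedes it below -/
import Mathlib

section
/- (Lemma 1) For every iteration index i ≥ 1, the dual variables of the ADMM distributed-averaging recursion satisfy Σ_{k=1}^n λ_k(i) = 0. -/
/-- Lemma 1: in the ADMM distributed-averaging recursion, for every
iteration `i ≥ 1`, the dual variables satisfy `∑ k, λ k i = 0`. -/
theorem admm_dual_sum_zero
    {E : Type*} [NormedAddCommGroup E] [InnerProductSpace ℝ E]
    (n : ℕ) (hn : 1 ≤ n) (ρ : ℝ) (hρ : 0 < ρ)
    (w : Fin n → E) (x lam : Fin n → ℕ → E) (z : ℕ → E)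
    (hx : ∀ i : ℕ, 1 ≤ i → ∀ k : Fin n,
      x k i = (2 + ρ)⁻¹ • ((2 : ℝ) • w k - lam k (i - 1) + ρ • z (i - 1)))
    (hz : ∀ i : ℕ, 1 ≤ i →
      z i = (n : ℝ)⁻¹ • ∑ k, (x k i + ρ⁻¹ • lam k (i - 1)))
    (hlam : ∀ i : ℕ, 1 ≤ i → ∀ k : Fin n,
      lam k i = lam k (i - 1) + ρ • (x k i - z i)) :
    ∀ i : ℕ, 1 ≤ i → ∑ k, lam k i = 0 := by
  intro i hi
  have hn' : (n : ℝ) ≠ 0 := by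
    exact_mod_cast (by omega : n ≠ 0)
  have hmean : (n : ℝ) • z i = ∑ k, x k i + ρ⁻¹ • ∑ k, lam k (i - 1) := by
    rw [hz i hi, smul_inv_smul₀ hn', Finset.sum_add_distrib, Finset.smul_sum]
  calc ∑ k, lam k i
      = ∑ k, (lam k (i - 1) + ρ • (x k i - z i)) :=
        Finset.sum_congr rfl fun k _ => hlam i hi k
    _ = ∑ k, lam k (i - 1) + ρ • (∑ k, x k i - (n : ℝ) • z i) := by
        rw [Finset.sum_add_distrib, ← Finset.smul_sum, Finset.sum_sub_distrib]
        simp [Nat.cast_smul_eq_nsmul]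
    _ = 0 := by
        rw [hmean, sub_add_cancel_left, smul_neg, smul_inv_smul₀ hρ.ne', add_neg_cancel]
end

section
/- (Lemma 2, exact form) Let z* = (1/n) Σ_{k=1}^n w_k. For every iteration index i ≥ 2, the consensus variable of the ADMM distributed-averaging recursion satisfies z(i) − z* = (ρ/(ρ+2))·(z(i−1) − z*); moreover this identity already holds for i = 1 provided Σ_{k=1}^n λ_k(0) = 0. -/
/-- Lemma 2, exact form: with `z* = (1/n) ∑ k, w k`, for every `i ≥ 2`
the consensus variable satisfies `z i − z* = (ρ/(ρ+2)) • (z (i−1) − z*)`; moreover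
the identity already holds for `i = 1` provided `∑ k, λ k 0 = 0`. -/
theorem admm_consensus_contraction
    {E : Type*} [NormedAddCommGroup E] [InnerProductSpace ℝ E]
    (n : ℕ) (hn : 1 ≤ n) (ρ : ℝ) (hρ : 0 < ρ)
    (w : Fin n → E) (x lam : Fin n → ℕ → E) (z : ℕ → E)
    (hx : ∀ i : ℕ, 1 ≤ i → ∀ k : Fin n,
      x k i = (2 + ρ)⁻¹ • ((2 : ℝ) • w k - lam k (i - 1) + ρ • z (i - 1)))
    (hz : ∀ i : ℕ, 1 ≤ i →
      z i = (n : ℝ)⁻¹ • ∑ k, (x k i + ρ⁻¹ • lam k (i - 1)))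
    (hlam : ∀ i : ℕ, 1 ≤ i → ∀ k : Fin n,
      lam k i = lam k (i - 1) + ρ • (x k i - z i))
    (zstar : E) (hzstar : zstar = (n : ℝ)⁻¹ • ∑ k, w k) :
    (∀ i : ℕ, 2 ≤ i → z i - zstar = (ρ / (ρ + 2)) • (z (i - 1) - zstar)) ∧
    ((∑ k, lam k 0 = 0) → z 1 - zstar = (ρ / (ρ + 2)) • (z 0 - zstar)) := by
  have hn0 : (n : ℝ) ≠ 0 := by positivity
  have hρ2 : ρ + 2 ≠ 0 := by positivity
  have hdual : ∀ i : ℕ, 1 ≤ i → ∑ k, lam k i = 0 := by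
    intro i hi
    have hnz : (n : ℝ) • z i = ∑ k, x k i + ρ⁻¹ • ∑ k, lam k (i - 1) := by
      rw [hz i hi, smul_inv_smul₀ hn0, Finset.sum_add_distrib, Finset.smul_sum]
    calc ∑ k, lam k i
        = ∑ k, lam k (i - 1) + ρ • (∑ k, x k i - (n : ℝ) • z i) := by
          simp only [hlam i hi, Finset.sum_add_distrib, ← Finset.smul_sum,
            Finset.sum_sub_distrib, Finset.sum_const, Finset.card_univ, Fintype.card_fin,
            Nat.cast_smul_eq_nsmul]
      _ = 0 := by
          rw [hnz, sub_add_cancel_left, smul_neg, smul_inv_smul₀ hρ.ne', add_neg_cancel]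
  have hstep : ∀ i : ℕ, 1 ≤ i → ∑ k, lam k (i - 1) = 0 →
      z i - zstar = (ρ / (ρ + 2)) • (z (i - 1) - zstar) := by
    intro i hi h0
    have hw : ∑ k, w k = (n : ℝ) • zstar := by rw [hzstar, smul_inv_smul₀ hn0]
    have hsum : ∑ k, x k i =
        (2 + ρ)⁻¹ • ((2 : ℝ) • (n : ℝ) • zstar + ρ • (n : ℝ) • z (i - 1)) := by
      simp only [hx i hi, ← Finset.smul_sum, Finset.sum_add_distrib, Finset.sum_sub_distrib,
        h0, hw, sub_zero, Finset.sum_const, Finset.card_univ, Fintype.card_fin,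
        Nat.cast_smul_eq_nsmul]
    rw [hz i hi, Finset.sum_add_distrib, ← Finset.smul_sum, h0, hsum, add_comm 2 ρ]
    match_scalars <;> field_simp
    ring
  exact ⟨fun i hi => hstep i (by lia) (hdual (i - 1) (by lia)), hstep 1 le_rfl⟩
end

section
/- (Linear convergence of the consensus variable) Let z* = (1/n) Σ_{k=1}^n w_k and assume Σ_{k=1}^n λ_k(0) = 0. Then for every i ≥ 0, ‖z(i) − z*‖ ≤ (ρ/(ρ+2))^i · ‖z(0) − z*‖, and consequently z(i) converges to z* as i → ∞. -/
open Filter Topology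

/-- Linear convergence of the consensus variable: with
`z* = (1/n) ∑ k, w k` and `∑ k, λ k 0 = 0`, for every `i ≥ 0` we have
`‖z i − z*‖ ≤ (ρ/(ρ+2))^i · ‖z 0 − z*‖`, and consequently `z i → z*`. -/
theorem admm_consensus_linear_convergence
    {E : Type*} [NormedAddCommGroup E] [InnerProductSpace ℝ E]
    (n : ℕ) (hn : 1 ≤ n) (ρ : ℝ) (hρ : 0 < ρ)
    (w : Fin n → E) (x lam : Fin n → ℕ → E) (z : ℕ → E)
    (hx : ∀ i : ℕ, 1 ≤ i → ∀ k : Fin n,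
      x k i = (2 + ρ)⁻¹ • ((2 : ℝ) • w k - lam k (i - 1) + ρ • z (i - 1)))
    (hz : ∀ i : ℕ, 1 ≤ i →
      z i = (n : ℝ)⁻¹ • ∑ k, (x k i + ρ⁻¹ • lam k (i - 1)))
    (hlam : ∀ i : ℕ, 1 ≤ i → ∀ k : Fin n,
      lam k i = lam k (i - 1) + ρ • (x k i - z i))
    (zstar : E) (hzstar : zstar = (n : ℝ)⁻¹ • ∑ k, w k)
    (hlam0 : ∑ k, lam k 0 = 0) :
    (∀ i : ℕ, ‖z i - zstar‖ ≤ (ρ / (ρ + 2)) ^ i * ‖z 0 - zstar‖) ∧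
    Tendsto z atTop (𝓝 zstar) := by
  have hn0 : (n : ℝ) ≠ 0 := by positivity
  have hlam_sum : ∀ i, ∑ k, lam k i = 0 := by
    intro i
    cases i with
    | zero => exact hlam0
    | succ i =>
      have hzi := hz (i + 1) (by simp)
      simp only [Nat.add_sub_cancel, Finset.sum_add_distrib, ← Finset.smul_sum] at hzi
      have hl : ∀ k, lam k (i + 1) = lam k i + ρ • (x k (i + 1) - z (i + 1)) :=
        fun k => hlam (i + 1) (by simp) k
      simp only [hl, Finset.sum_add_distrib, ← Finset.smul_sum, Finset.sum_sub_distrib,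
        Finset.sum_const, Finset.card_univ, Fintype.card_fin, ← Nat.cast_smul_eq_nsmul ℝ]
      rw [hzi]
      match_scalars <;> field_simp <;> ring
  have hstep : ∀ i, z (i + 1) - zstar = (ρ / (ρ + 2)) • (z i - zstar) := by
    intro i
    have hxi : ∀ k, x k (i + 1) = (2 + ρ)⁻¹ • ((2 : ℝ) • w k - lam k i + ρ • z i) :=
      fun k => hx (i + 1) (by simp) k
    rw [hz (i + 1) (by simp), hzstar]
    simp only [Nat.add_sub_cancel, hxi, Finset.sum_add_distrib, ← Finset.smul_sum,
      Finset.sum_sub_distrib, hlam_sum, Finset.sum_const, Finset.card_univ, Fintype.card_fin,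
      ← Nat.cast_smul_eq_nsmul ℝ]
    match_scalars <;> field_simp <;> ring
  have hpow : ∀ i, z i - zstar = (ρ / (ρ + 2)) ^ i • (z 0 - zstar) := by
    intro i
    induction i with
    | zero => simp
    | succ i ih => rw [hstep, ih, smul_smul, ← pow_succ']
  have hbound : ∀ i, ‖z i - zstar‖ ≤ (ρ / (ρ + 2)) ^ i * ‖z 0 - zstar‖ := by
    intro i
    rw [hpow i, norm_smul, Real.norm_of_nonneg (by positivity)]
  refine ⟨hbound, ?_⟩
  have hrate : ρ / (ρ + 2) < 1 := by
    rw [div_lt_one (by positivity)]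
    linarith
  rw [tendsto_iff_norm_sub_tendsto_zero]
  refine squeeze_zero (fun _ => norm_nonneg _) hbound ?_
  simpa using (tendsto_pow_atTop_nhds_zero_of_lt_one (by positivity) hrate).mul_const
    ‖z 0 - zstar‖
end

section
/- (Zero initialization closed form) Assume z(0) = 0 and Σ_{k=1}^n λ_k(0) = 0, and let z* = (1/n) Σ_{k=1}^n w_k. Then for every iteration count I ≥ 0, z(I) = (1 − (ρ/(ρ+2))^I) · z*. -/
/-- Zero initialization closed form: if `z 0 = 0` and `∑ k, λ k 0 = 0`,
then with `z* = (1/n) ∑ k, w k`, for every `I ≥ 0`, `z I = (1 − (ρ/(ρ+2))^I) • z*`. -/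
theorem admm_zero_init_closed_form
    {E : Type*} [NormedAddCommGroup E] [InnerProductSpace ℝ E]
    (n : ℕ) (hn : 1 ≤ n) (ρ : ℝ) (hρ : 0 < ρ)
    (w : Fin n → E) (x lam : Fin n → ℕ → E) (z : ℕ → E)
    (hx : ∀ i : ℕ, 1 ≤ i → ∀ k : Fin n,
      x k i = (2 + ρ)⁻¹ • ((2 : ℝ) • w k - lam k (i - 1) + ρ • z (i - 1)))
    (hz : ∀ i : ℕ, 1 ≤ i →
      z i = (n : ℝ)⁻¹ • ∑ k, (x k i + ρ⁻¹ • lam k (i - 1)))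
    (hlam : ∀ i : ℕ, 1 ≤ i → ∀ k : Fin n,
      lam k i = lam k (i - 1) + ρ • (x k i - z i))
    (zstar : E) (hzstar : zstar = (n : ℝ)⁻¹ • ∑ k, w k)
    (hz0 : z 0 = 0) (hlam0 : ∑ k, lam k 0 = 0) :
    ∀ I : ℕ, z I = (1 - (ρ / (ρ + 2)) ^ I) • zstar := by
  have hn' : (n : ℝ) ≠ 0 := by positivity
  have hρ2 : ρ + 2 ≠ 0 := by positivity
  have hw : ∑ k, w k = (n : ℝ) • zstar := by rw [hzstar, smul_inv_smul₀ hn']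
  suffices h : ∀ I : ℕ, ∑ k, lam k I = 0 ∧ z I = (1 - (ρ / (ρ + 2)) ^ I) • zstar from
    fun I => (h I).2
  intro I
  induction I with
  | zero => simp [hz0, hlam0]
  | succ I ih =>
    obtain ⟨hl, hzI⟩ := ih
    have hX : ∑ k, x k (I + 1) =
        (2 + ρ)⁻¹ • ((2 : ℝ) • (n : ℝ) • zstar + ρ • (n : ℝ) • z I) := by
      simp only [hx (I + 1) (by omega), Nat.add_sub_cancel]
      rw [← Finset.smul_sum, Finset.sum_add_distrib, Finset.sum_sub_distrib, hl,
        ← Finset.smul_sum, hw, Finset.sum_const, Finset.card_univ, Fintype.card_fin,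
        ← Nat.cast_smul_eq_nsmul ℝ, smul_comm (n : ℝ) ρ, sub_zero]
    have hzX : z (I + 1) = (n : ℝ)⁻¹ • ∑ k, x k (I + 1) := by
      rw [hz (I + 1) (by omega), Nat.add_sub_cancel, Finset.sum_add_distrib,
        ← Finset.smul_sum, hl, smul_zero, add_zero]
    constructor
    · simp only [hlam (I + 1) (by omega), Nat.add_sub_cancel]
      rw [Finset.sum_add_distrib, hl, ← Finset.smul_sum, Finset.sum_sub_distrib,
        Finset.sum_const, Finset.card_univ, Fintype.card_fin, ← Nat.cast_smul_eq_nsmul ℝ,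
        hzX, smul_inv_smul₀ hn', sub_self, smul_zero, add_zero]
    · rw [hzX, hX, hzI]
      simp only [smul_smul, ← add_smul]
      congr 1
      rw [pow_succ, add_comm 2 ρ]
      generalize (ρ / (ρ + 2)) ^ I = r
      field_simp
      ring
end

section
/- (Lemma 3: private data recovered from two consecutive rounds) Define the communicated messages y_k(i) = x_k(i) + (1/ρ)·λ_k(i−1) for i ≥ 1. Then for every participant k, the private vector w_k is determined explicitly by the messages of the first two iterations and the consensus value z(1): w_k = ( (2+ρ)·( y_k(2) − (y_k(1) − z(1)) ) + ρ·(y_k(1) − z(1)) − ρ·z(1) ) / 2. In particular, an observer who knows ρ, z(1), y_k(1), and y_k(2) can compute w_k. -/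
/-- Lemma 3: private data recovered from two consecutive rounds:
with messages `y k i = x k i + (1/ρ) • λ k (i−1)` for `i ≥ 1`, for every
participant `k`,
`w k = ((2+ρ) • (y k 2 − (y k 1 − z 1)) + ρ • (y k 1 − z 1) − ρ • z 1) / 2`. -/
theorem admm_private_data_recovery
    {E : Type*} [NormedAddCommGroup E] [InnerProductSpace ℝ E]
    (n : ℕ) (hn : 1 ≤ n) (ρ : ℝ) (hρ : 0 < ρ)
    (w : Fin n → E) (x lam : Fin n → ℕ → E) (z : ℕ → E)
    (hx : ∀ i : ℕ, 1 ≤ i → ∀ k : Fin n,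
      x k i = (2 + ρ)⁻¹ • ((2 : ℝ) • w k - lam k (i - 1) + ρ • z (i - 1)))
    (hz : ∀ i : ℕ, 1 ≤ i →
      z i = (n : ℝ)⁻¹ • ∑ k, (x k i + ρ⁻¹ • lam k (i - 1)))
    (hlam : ∀ i : ℕ, 1 ≤ i → ∀ k : Fin n,
      lam k i = lam k (i - 1) + ρ • (x k i - z i))
    (y : Fin n → ℕ → E)
    (hy : ∀ i : ℕ, 1 ≤ i → ∀ k : Fin n,
      y k i = x k i + ρ⁻¹ • lam k (i - 1)) :
    ∀ k : Fin n,
      w k = (2 : ℝ)⁻¹ •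
        ((2 + ρ) • (y k 2 - (y k 1 - z 1)) + ρ • (y k 1 - z 1) - ρ • z 1) := by
  intro k
  have hdual : lam k 1 = ρ • (y k 1 - z 1) := by
    rw [hlam 1 le_rfl k, hy 1 le_rfl k]
    simp only [smul_sub, smul_add, smul_inv_smul₀ hρ.ne']
    abel
  have hx₂ : y k 2 - (y k 1 - z 1) = x k 2 := by
    rw [hy 2 one_le_two k, hdual, inv_smul_smul₀ hρ.ne', add_sub_cancel_right]
  have hprimal : (2 + ρ) • x k 2 = (2 : ℝ) • w k - lam k 1 + ρ • z 1 := by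
    rw [hx 2 one_le_two k, smul_inv_smul₀ (by positivity)]
  rw [hx₂, hprimal, ← hdual, eq_inv_smul_iff₀ two_ne_zero]
  abel
end
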